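/- For θ ∈ [0,1) define the symmetric stable density f(x;θ) = (1/π) ∫₀^∞ cos(tx) · exp(−t^{2−θ}) dt, so that f(·;0) is the density of N(0,2), and define D(x) = (1/π) ∫₀^∞ cos(tx) · t² · log t · exp(−t²) dt. Fix n ≥ 3 and k ∈ ℝ, and for z with Σzᵢ = 0, Σzᵢ² = n set T(z) = ∫₀^∞ ∫_{-∞}^∞ Σ_{i=1}^n [ D(a+b·zᵢ) / f(a+b·zᵢ;0) ] · exp(−n(a²+b²)/4) · b^{n−2} da db, and R* = { x ∈ ℝⁿ : s(x) > 0 and T(z(x)) > k }. Then: (i) for every location-scale invariant measurable set R ⊆ ℝⁿ, the power function β_R(θ) = ∫_R ∏_{i=1}^n f(xᵢ;θ) dx is right-differentiable at θ = 0 with β_R′(0) = ∫_R Σ_{i=1}^n [D(xᵢ)/f(xᵢ;0)] · ∏_{j=1}^n f(xⱼ;0) dx; and (ii) for every such R with β_R(0) = β_{R*}(0), one has β_R′(0) ≤ β_{R*}′(0). That is, T gives the locally best invariant test of normality against the symmetric stable family. -/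

import Mathlib

open MeasureTheory

/-- The symmetric stable density in Zolotarev's (M) parametrization with `θ = 2 - α`:
`f(x;θ) = (1/π) ∫₀^∞ cos(tx) exp(-t^{2-θ}) dt`; `f(·;0)` is the `N(0,2)` density. -/
noncomputable def symStablePdf (x θ : ℝ) : ℝ :=
  (1 / Real.pi) * ∫ t in Set.Ioi (0 : ℝ), Real.cos (t * x) * Real.exp (-(t ^ (2 - θ)))

/-- `D(x) = ∂f(x;θ)/∂θ` at `θ = 0`: `D(x) = (1/π) ∫₀^∞ cos(tx) t² log t exp(-t²) dt`. -/
noncomputable def symStableDeriv (x : ℝ) : ℝ :=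
  (1 / Real.pi) * ∫ t in Set.Ioi (0 : ℝ), Real.cos (t * x) * t ^ 2 * Real.log t *
    Real.exp (-(t ^ 2))

/-- The LBI statistic against the symmetric stable family:
`T(z) = ∫₀^∞ ∫ℝ ∑ᵢ [D(a+bzᵢ)/f(a+bzᵢ;0)] exp(-n(a²+b²)/4) b^{n-2} da db`. -/
noncomputable def stableLbiStat (n : ℕ) (z : Fin n → ℝ) : ℝ :=
  ∫ b in Set.Ioi (0 : ℝ), ∫ a : ℝ,
    (∑ i, symStableDeriv (a + b * z i) / symStablePdf (a + b * z i) 0) *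
      Real.exp (-((n : ℝ) * (a ^ 2 + b ^ 2)) / 4) * b ^ (n - 2)

/-- Sample mean. -/
noncomputable def sampMean (n : ℕ) (x : Fin n → ℝ) : ℝ := (∑ i, x i) / n

/-- Sample standard deviation `s(x)` (with divisor `n`). -/
noncomputable def sampSD (n : ℕ) (x : Fin n → ℝ) : ℝ :=
  Real.sqrt ((∑ i, (x i - sampMean n x) ^ 2) / n)

/-- The standardized vector `z(x)`. -/
noncomputable def stdized (n : ℕ) (x : Fin n → ℝ) : Fin n → ℝ :=
  fun i => (x i - sampMean n x) / sampSD n x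


open Set Filter Topology

/-- A majorant that is `O(t^{5/4})` at the origin and `O(t^{-5/4})` at infinity. -/
noncomputable def quarticDecay (t : ℝ) : ℝ := min (t ^ (5 / 4 : ℝ)) (t ^ (-(5 / 4) : ℝ))

lemma quarticDecay_of_le_one {t : ℝ} (ht : 0 < t) (h : t ≤ 1) :
    quarticDecay t = t ^ (5 / 4 : ℝ) :=
  min_eq_left (Real.rpow_le_rpow_of_exponent_ge ht h (by norm_num))

lemma quarticDecay_of_one_le {t : ℝ} (h : 1 ≤ t) :
    quarticDecay t = t ^ (-(5 / 4) : ℝ) :=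
  min_eq_right (Real.rpow_le_rpow_of_exponent_le h (by norm_num))

lemma quarticDecay_nonneg {t : ℝ} (ht : 0 ≤ t) : 0 ≤ quarticDecay t :=
  le_min (Real.rpow_nonneg ht _) (Real.rpow_nonneg ht _)

lemma measurable_quarticDecay : Measurable quarticDecay := by
  unfold quarticDecay; fun_prop

/-- Integrability on `(0, ∞)` of a function dominated by powers near the two ends. -/
lemma integrableOn_Ioi_of_le_rpow {f : ℝ → ℝ} {r s : ℝ} (hf : Measurable f) (hr : -1 < r)
    (hs : s < -1) (h0 : ∀ t, 0 < t → t ≤ 1 → |f t| ≤ t ^ r) (h1 : ∀ t, 1 ≤ t → |f t| ≤ t ^ s) :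
    IntegrableOn f (Ioi 0) := by
  rw [← Ioc_union_Ioi_eq_Ioi (zero_le_one (α := ℝ))]
  refine IntegrableOn.union ?_ ?_
  · have : IntegrableOn (fun t : ℝ => t ^ r) (Ioc 0 1) :=
      (intervalIntegrable_iff_integrableOn_Ioc_of_le zero_le_one).1
        (intervalIntegral.intervalIntegrable_rpow' hr)
    refine Integrable.mono' this hf.aestronglyMeasurable ?_
    filter_upwards [ae_restrict_mem measurableSet_Ioc] with t ht using h0 t ht.1 ht.2
  · refine Integrable.mono' (integrableOn_Ioi_rpow_of_lt hs zero_lt_one)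
      hf.aestronglyMeasurable ?_
    filter_upwards [ae_restrict_mem measurableSet_Ioi] with t ht using h1 t (le_of_lt ht)

lemma integrableOn_quarticDecay : IntegrableOn quarticDecay (Ioi 0) := by
  refine integrableOn_Ioi_of_le_rpow (r := 5 / 4) (s := -(5 / 4)) measurable_quarticDecay
    (by norm_num) (by norm_num) (fun t h0 h1 => ?_) (fun t h1 => ?_)
  · rw [abs_of_nonneg (quarticDecay_nonneg h0.le), quarticDecay_of_le_one h0 h1]
  · rw [abs_of_nonneg (quarticDecay_nonneg (by linarith)), quarticDecay_of_one_le h1]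

lemma integrableOn_quarticDecay_div_sq :
    IntegrableOn (fun t => quarticDecay t / t ^ 2) (Ioi 0) := by
  refine integrableOn_Ioi_of_le_rpow (r := -(3 / 4)) (s := -(5 / 4))
    (measurable_quarticDecay.div (by fun_prop))
    (by norm_num) (by norm_num) (fun t h0 h1 => ?_) (fun t h1 => ?_)
  · rw [abs_of_nonneg (div_nonneg (quarticDecay_nonneg h0.le) (sq_nonneg t)),
      quarticDecay_of_le_one h0 h1, ← Real.rpow_natCast, ← Real.rpow_sub h0]
    norm_num
  · have h0 : 0 < t := by linarith
    rw [abs_of_nonneg (div_nonneg (quarticDecay_nonneg h0.le) (sq_nonneg t)),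
      quarticDecay_of_one_le h1]
    exact div_le_self (Real.rpow_nonneg h0.le _) (one_le_pow₀ h1)

lemma tendsto_quarticDecay_atTop : Tendsto quarticDecay atTop (𝓝 0) := by
  refine (tendsto_rpow_neg_atTop (y := 5 / 4) (by norm_num)).congr' ?_
  filter_upwards [eventually_ge_atTop 1] with t ht using (quarticDecay_of_one_le ht).symm

lemma tendsto_quarticDecay_div_atTop : Tendsto (fun t => quarticDecay t / t) atTop (𝓝 0) :=
  tendsto_quarticDecay_atTop.div_atTop tendsto_id

lemma tendsto_quarticDecay_div_zero : Tendsto (fun t => quarticDecay t / t) (𝓝[>] 0) (𝓝 0) := by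
  have h : Tendsto (fun t : ℝ => t ^ (1 / 4 : ℝ)) (𝓝[>] 0) (𝓝 0) := by
    have := (Real.continuousAt_rpow_const 0 (1 / 4 : ℝ) (Or.inr (by norm_num))).tendsto
    rw [Real.zero_rpow (by norm_num)] at this
    exact this.mono_left nhdsWithin_le_nhds
  refine h.congr' ?_
  filter_upwards [Ioc_mem_nhdsGT (zero_lt_one (α := ℝ))] with t ht
  rw [quarticDecay_of_le_one ht.1 ht.2, ← Real.rpow_sub_one ht.1.ne']
  norm_num

lemma tendsto_quarticDecay_zero : Tendsto quarticDecay (𝓝[>] 0) (𝓝 0) := by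
  have h := tendsto_quarticDecay_div_zero.mul
    ((tendsto_id (α := ℝ) (x := 𝓝 0)).mono_left (nhdsWithin_le_nhds (s := Ioi 0)))
  simp only [mul_zero, id] at h
  refine h.congr' ?_
  filter_upwards [self_mem_nhdsWithin] with t ht
  exact div_mul_cancel₀ _ (ne_of_gt ht)

/-- Two integrations by parts: quadratic decay of a cosine transform. -/
lemma abs_integral_cos_mul_le {g g' g'' : ℝ → ℝ} {C : ℝ}
    (hg : ∀ t, 0 < t → HasDerivAt g (g' t) t) (hg' : ∀ t, 0 < t → HasDerivAt g' (g'' t) t)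
    (mg : Measurable g) (mg'' : Measurable g'')
    (bg : ∀ t, 0 < t → |g t| ≤ C * quarticDecay t)
    (bg' : ∀ t, 0 < t → |g' t| ≤ C * (quarticDecay t / t))
    (bg'' : ∀ t, 0 < t → |g'' t| ≤ C * (quarticDecay t / t ^ 2)) (x : ℝ) :
    |∫ t in Ioi (0 : ℝ), Real.cos (t * x) * g t| ≤
      C * ((∫ t in Ioi (0 : ℝ), quarticDecay t) + ∫ t in Ioi (0 : ℝ), quarticDecay t / t ^ 2) /
        (1 + x ^ 2) := by
  set A := ∫ t in Ioi (0 : ℝ), quarticDecay t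
  set B := ∫ t in Ioi (0 : ℝ), quarticDecay t / t ^ 2
  have cosb : ∀ (h E : ℝ → ℝ), (∀ t, 0 < t → |h t| ≤ C * E t) →
      ∀ t, 0 < t → ‖Real.cos (t * x) * h t‖ ≤ C * E t := fun h E hh t ht => by
    rw [Real.norm_eq_abs, abs_mul]
    exact (mul_le_of_le_one_left (abs_nonneg _) (Real.abs_cos_le_one _)).trans (hh t ht)
  have ae_pos : ∀ {q : ℝ → Prop}, (∀ t, 0 < t → q t) →
      ∀ᵐ t ∂(volume.restrict (Ioi (0 : ℝ))), q t := fun {q} hq => by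
    filter_upwards [ae_restrict_mem measurableSet_Ioi] with t ht using hq t ht
  have ig : IntegrableOn (fun t => Real.cos (t * x) * g t) (Ioi 0) :=
    Integrable.mono' (integrableOn_quarticDecay.const_mul C)
      (by fun_prop) (ae_pos (cosb g _ bg))
  have ig'' : IntegrableOn (fun t => Real.cos (t * x) * g'' t) (Ioi 0) :=
    Integrable.mono' (integrableOn_quarticDecay_div_sq.const_mul C)
      (by fun_prop) (ae_pos (cosb g'' _ bg''))
  have h1 : |∫ t in Ioi (0 : ℝ), Real.cos (t * x) * g t| ≤ C * A := by
    have := norm_integral_le_of_norm_le (integrableOn_quarticDecay.const_mul C)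
      (ae_pos (cosb g _ bg))
    rwa [integral_const_mul] at this
  have h2 : |∫ t in Ioi (0 : ℝ), Real.cos (t * x) * g'' t| ≤ C * B := by
    have := norm_integral_le_of_norm_le (integrableOn_quarticDecay_div_sq.const_mul C)
      (ae_pos (cosb g'' _ bg''))
    rwa [integral_const_mul] at this
  let H : ℝ → ℝ := fun t => x * Real.sin (t * x) * g t + Real.cos (t * x) * g' t
  have dH : ∀ t, 0 < t → HasDerivAt H
      (x ^ 2 * (Real.cos (t * x) * g t) + Real.cos (t * x) * g'' t) t := fun t ht => by
    have hx : HasDerivAt (fun t : ℝ => t * x) x t := by simpa using (hasDerivAt_id t).mul_const x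
    have := ((hx.sin.const_mul x).mul (hg t ht)).add (hx.cos.mul (hg' t ht))
    refine this.congr_deriv ?_
    ring
  have bH : ∀ t, 0 < t → ‖H t‖ ≤ |x| * (C * quarticDecay t) + C * (quarticDecay t / t) :=
    fun t ht => by
      refine (norm_add_le _ _).trans (add_le_add ?_ ?_)
      · rw [norm_mul, norm_mul, Real.norm_eq_abs, Real.norm_eq_abs, Real.norm_eq_abs]
        exact mul_le_mul (mul_le_of_le_one_right (abs_nonneg _) (Real.abs_sin_le_one _))
          (bg t ht) (abs_nonneg _) (abs_nonneg _)
      · exact cosb g' _ bg' t ht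
  have lim : ∀ l : Filter ℝ, (∀ᶠ t in l, 0 < t) → Tendsto quarticDecay l (𝓝 0) →
      Tendsto (fun t => quarticDecay t / t) l (𝓝 0) → Tendsto H l (𝓝 0) := fun l hl e1 e2 => by
    refine squeeze_zero_norm' (hl.mono bH) ?_
    simpa using ((e1.const_mul C).const_mul |x|).add (e2.const_mul C)
  have key := integral_Ioi_of_hasDerivAt_of_tendsto (f := Function.update H 0 0) (a := 0) (m := 0)
    (f' := fun t => x ^ 2 * (Real.cos (t * x) * g t) + Real.cos (t * x) * g'' t)
    (by
      rw [continuousWithinAt_update_same]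
      have := lim (𝓝[>] 0) self_mem_nhdsWithin tendsto_quarticDecay_zero
        tendsto_quarticDecay_div_zero
      simpa using this)
    (fun t ht => (dH t ht).congr_of_eventuallyEq (by
      filter_upwards [isOpen_Ioi.mem_nhds ht] with s hs
      exact Function.update_of_ne (ne_of_gt hs) _ _))
    ((ig.const_mul _).add ig'')
    ((lim atTop (eventually_gt_atTop 0) tendsto_quarticDecay_atTop
      tendsto_quarticDecay_div_atTop).congr' (by
        filter_upwards [eventually_gt_atTop 0] with s hs
        exact (Function.update_of_ne (ne_of_gt hs) _ _).symm))
  rw [integral_add (ig.const_mul _) ig'', integral_const_mul] at key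
  simp only [Function.update_self, sub_zero] at key
  rw [le_div_iff₀ (by positivity)]
  set I := ∫ t in Ioi (0 : ℝ), Real.cos (t * x) * g t
  have h3 : x ^ 2 * |I| ≤ C * B := by
    rw [← abs_of_nonneg (sq_nonneg x), ← abs_mul, eq_neg_of_add_eq_zero_left key, abs_neg]
    exact h2
  linarith

/-- The `t`-profile `t^p log t exp(-t^p)` of the `θ`-derivative of the stable density. -/
noncomputable def logProfile (p t : ℝ) : ℝ := t ^ p * Real.log t * Real.exp (-(t ^ p))

/-- First derivative of `logProfile p`. -/
noncomputable def logProfile' (p t : ℝ) : ℝ :=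
  (p * t ^ p * Real.log t + t ^ p - p * (t ^ p) ^ 2 * Real.log t) * Real.exp (-(t ^ p)) / t

/-- Second derivative of `logProfile p`. -/
noncomputable def logProfile'' (p t : ℝ) : ℝ :=
  (Real.log t * (p ^ 2 * t ^ p - 3 * p ^ 2 * (t ^ p) ^ 2 + p ^ 2 * (t ^ p) ^ 3 - p * t ^ p
    + p * (t ^ p) ^ 2) + 2 * p * t ^ p - 2 * p * (t ^ p) ^ 2 - t ^ p) *
      Real.exp (-(t ^ p)) / t ^ 2

lemma hasDerivAt_rpow_div (p : ℝ) {t : ℝ} (ht : 0 < t) :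
    HasDerivAt (fun t : ℝ => t ^ p) (p * t ^ p / t) t := by
  have := Real.hasDerivAt_rpow_const (x := t) (p := p) (Or.inl ht.ne')
  rwa [Real.rpow_sub_one ht.ne', ← mul_div_assoc] at this

lemma hasDerivAt_logProfile (p : ℝ) {t : ℝ} (ht : 0 < t) :
    HasDerivAt (logProfile p) (logProfile' p t) t := by
  have hu := hasDerivAt_rpow_div p ht
  refine ((hu.mul (Real.hasDerivAt_log ht.ne')).mul hu.neg.exp).congr_deriv ?_
  unfold logProfile'
  simp only [Pi.mul_apply, Pi.neg_apply]
  field_simp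
  ring

lemma hasDerivAt_logProfile' (p : ℝ) {t : ℝ} (ht : 0 < t) :
    HasDerivAt (logProfile' p) (logProfile'' p t) t := by
  have hu := hasDerivAt_rpow_div p ht
  have hl := Real.hasDerivAt_log ht.ne'
  refine ((((((hu.const_mul p).mul hl).add hu).sub (((hu.pow 2).const_mul p).mul hl)).mul
    hu.neg.exp).div (hasDerivAt_id t) ht.ne').congr_deriv ?_
  unfold logProfile''
  simp only [Pi.mul_apply, Pi.neg_apply, Pi.add_apply, Pi.sub_apply, Pi.pow_apply, id]
  field_simp
  ring

lemma measurable_logProfile (p : ℝ) : Measurable (logProfile p) := by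
  unfold logProfile; fun_prop

lemma measurable_logProfile'' (p : ℝ) : Measurable (logProfile'' p) := by
  unfold logProfile''; fun_prop

lemma rpow_quarter_mul_abs_log_le {t : ℝ} (ht : 0 < t) (h : t ≤ 1) :
    t ^ (1 / 4 : ℝ) * |Real.log t| ≤ 4 := by
  have := (Real.abs_log_mul_self_rpow_lt t (1 / 4) ht h (by norm_num)).le
  rw [abs_mul, abs_of_nonneg (Real.rpow_nonneg ht.le _)] at this
  linarith

lemma one_add_abs_log_le {t : ℝ} (h : 1 ≤ t) :
    1 + |Real.log t| ≤ 5 * t ^ (1 / 4 : ℝ) := by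
  have h1 := Real.log_le_rpow_div (x := t) (ε := 1 / 4) (by linarith) (by norm_num)
  have h2 := Real.one_le_rpow h (z := 1 / 4) (by norm_num)
  rw [abs_of_nonneg (Real.log_nonneg h)]
  linarith

lemma pow_mul_exp_mul_log_le {p t : ℝ} (hp : 3 / 2 ≤ p) (ht : 0 < t) {k : ℕ} (hk : k ≠ 0) :
    (t ^ p) ^ k * Real.exp (-(t ^ p)) * (1 + |Real.log t|) ≤
      5 * (k + 1).factorial * quarticDecay t := by
  have hu0 : 0 < t ^ p := Real.rpow_pos_of_pos ht p
  have hfac : (1 : ℝ) ≤ (k + 1).factorial := by exact_mod_cast (k + 1).factorial_pos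
  rcases le_total t 1 with h | h
  · have hu1 : t ^ p ≤ 1 := Real.rpow_le_one ht.le h (by linarith)
    have hu : t ^ p ≤ t ^ (5 / 4 : ℝ) * t ^ (1 / 4 : ℝ) := by
      rw [← Real.rpow_add ht]
      exact Real.rpow_le_rpow_of_exponent_ge ht h (by linarith)
    have hq : t ^ (1 / 4 : ℝ) ≤ 1 := Real.rpow_le_one ht.le h (by norm_num)
    have h5 := Real.rpow_pos_of_pos ht (5 / 4)
    have hue : (t ^ p) ^ k * Real.exp (-(t ^ p)) ≤ t ^ p :=
      (mul_le_of_le_one_right (by positivity) (Real.exp_le_one_iff.2 (by linarith))).trans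
        (pow_le_of_le_one hu0.le hu1 hk)
    rw [quarticDecay_of_le_one ht h]
    calc _ ≤ (t ^ (5 / 4 : ℝ) * t ^ (1 / 4 : ℝ)) * (1 + |Real.log t|) := by
          exact mul_le_mul_of_nonneg_right (hue.trans hu) (by positivity)
      _ = t ^ (5 / 4 : ℝ) * (t ^ (1 / 4 : ℝ) + t ^ (1 / 4 : ℝ) * |Real.log t|) := by ring
      _ ≤ t ^ (5 / 4 : ℝ) * (1 + 4) := by
          gcongr; exact rpow_quarter_mul_abs_log_le ht h
      _ = 5 * 1 * t ^ (5 / 4 : ℝ) := by ring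
      _ ≤ _ := by gcongr
  · have hu : t ^ (3 / 2 : ℝ) ≤ t ^ p := Real.rpow_le_rpow_of_exponent_le h hp
    have h3 := Real.rpow_pos_of_pos ht (3 / 2)
    have hue : (t ^ p) ^ k * Real.exp (-(t ^ p)) ≤ (k + 1).factorial / t ^ (3 / 2 : ℝ) := by
      have := Real.pow_div_factorial_le_exp (t ^ p) hu0.le (k + 1)
      rw [div_le_iff₀ (by positivity)] at this
      rw [Real.exp_neg, ← div_eq_mul_inv, div_le_div_iff₀ (Real.exp_pos _) h3]
      calc _ ≤ (t ^ p) ^ k * t ^ p := by gcongr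
        _ = (t ^ p) ^ (k + 1) := by ring
        _ ≤ _ := by linarith
    rw [quarticDecay_of_one_le h]
    calc _ ≤ (k + 1).factorial / t ^ (3 / 2 : ℝ) * (5 * t ^ (1 / 4 : ℝ)) := by
          gcongr; exact one_add_abs_log_le h
      _ = 5 * (k + 1).factorial * (t ^ (1 / 4 : ℝ) / t ^ (3 / 2 : ℝ)) := by ring
      _ = _ := by rw [← Real.rpow_sub ht]; norm_num

lemma abs_le_of_eq_poly_mul_exp {p t : ℝ} (hp : p ∈ Icc (3 / 2 : ℝ) (5 / 2)) (ht : 0 < t) {y : ℝ}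
    (hy : |y| ≤ 50 * (1 + |Real.log t|) * (t ^ p + (t ^ p) ^ 2 + (t ^ p) ^ 3)) :
    |y * Real.exp (-(t ^ p))| ≤ 10000 * quarticDecay t := by
  have h1 := pow_mul_exp_mul_log_le hp.1 ht (k := 1) (by norm_num)
  have h2 := pow_mul_exp_mul_log_le hp.1 ht (k := 2) (by norm_num)
  have h3 := pow_mul_exp_mul_log_le hp.1 ht (k := 3) (by norm_num)
  have hE := quarticDecay_nonneg ht.le
  norm_num [Nat.factorial] at h1 h2 h3
  rw [abs_mul, abs_of_pos (Real.exp_pos _)]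
  calc _ ≤ 50 * (1 + |Real.log t|) * (t ^ p + (t ^ p) ^ 2 + (t ^ p) ^ 3) *
        Real.exp (-(t ^ p)) := by gcongr
    _ = 50 * (t ^ p * Real.exp (-(t ^ p)) * (1 + |Real.log t|) +
        (t ^ p) ^ 2 * Real.exp (-(t ^ p)) * (1 + |Real.log t|) +
        (t ^ p) ^ 3 * Real.exp (-(t ^ p)) * (1 + |Real.log t|)) := by ring
    _ ≤ _ := by linarith

lemma abs_logProfile_le {p t : ℝ} (hp : p ∈ Icc (3 / 2 : ℝ) (5 / 2)) (ht : 0 < t) :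
    |logProfile p t| ≤ 10000 * quarticDecay t := by
  refine abs_le_of_eq_poly_mul_exp hp ht ?_
  have hu := Real.rpow_pos_of_pos ht p
  have hl := abs_nonneg (Real.log t)
  rw [abs_mul, abs_of_pos hu]
  nlinarith [mul_nonneg hl hu.le, mul_nonneg hl (pow_pos hu 2).le, mul_nonneg hl (pow_pos hu 3).le,
    pow_pos hu 2, pow_pos hu 3]

lemma abs_logProfile'_le {p t : ℝ} (hp : p ∈ Icc (3 / 2 : ℝ) (5 / 2)) (ht : 0 < t) :
    |logProfile' p t| ≤ 10000 * (quarticDecay t / t) := by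
  rw [logProfile', abs_div, abs_of_pos ht, ← mul_div_assoc]
  refine div_le_div_of_nonneg_right (abs_le_of_eq_poly_mul_exp hp ht ?_) ht.le
  obtain ⟨hp1, hp2⟩ := hp
  have hu := Real.rpow_pos_of_pos ht p
  generalize t ^ p = u at hu
  have e : p * u * Real.log t + u - p * u ^ 2 * Real.log t =
    Real.log t * (p * u) + u + Real.log t * (-(p * u ^ 2)) := by ring
  rw [e]
  generalize Real.log t = L
  have hl := abs_nonneg L
  have a1 : |p * u| ≤ 3 * u := by rw [abs_of_nonneg (by positivity)]; gcongr; linarith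
  have a2 : |-(p * u ^ 2)| ≤ 3 * u ^ 2 := by
    rw [abs_neg, abs_of_nonneg (by positivity)]; gcongr; linarith
  calc _ ≤ |L| * |p * u| + |u| + |L| * |-(p * u ^ 2)| := by
        rw [← abs_mul, ← abs_mul]; exact abs_add_three _ _ _
    _ ≤ |L| * (3 * u) + u + |L| * (3 * u ^ 2) := by rw [abs_of_pos hu]; gcongr
    _ ≤ _ := by
      nlinarith [mul_nonneg hl hu.le, mul_nonneg hl (pow_pos hu 2).le,
        mul_nonneg hl (pow_pos hu 3).le, pow_pos hu 2, pow_pos hu 3]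

lemma abs_logProfile''_le {p t : ℝ} (hp : p ∈ Icc (3 / 2 : ℝ) (5 / 2)) (ht : 0 < t) :
    |logProfile'' p t| ≤ 10000 * (quarticDecay t / t ^ 2) := by
  rw [logProfile'', abs_div, abs_of_pos (pow_pos ht 2), ← mul_div_assoc]
  refine div_le_div_of_nonneg_right (abs_le_of_eq_poly_mul_exp hp ht ?_) (sq_nonneg t)
  obtain ⟨hp1, hp2⟩ := hp
  have hu := Real.rpow_pos_of_pos ht p
  generalize t ^ p = u at hu
  have e : Real.log t * (p ^ 2 * u - 3 * p ^ 2 * u ^ 2 + p ^ 2 * u ^ 3 - p * u + p * u ^ 2) +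
      2 * p * u - 2 * p * u ^ 2 - u = Real.log t * ((p ^ 2 - p) * u + (p - 3 * p ^ 2) * u ^ 2 +
        p ^ 2 * u ^ 3) + ((2 * p - 1) * u + -2 * p * u ^ 2) := by ring
  rw [e]
  generalize Real.log t = L
  have hl := abs_nonneg L
  have c1 : |p ^ 2 - p| ≤ 40 := abs_le.2 ⟨by nlinarith, by nlinarith⟩
  have c2 : |p - 3 * p ^ 2| ≤ 40 := abs_le.2 ⟨by nlinarith, by nlinarith⟩
  have c3 : |p ^ 2| ≤ 40 := abs_le.2 ⟨by nlinarith, by nlinarith⟩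
  have c4 : |2 * p - 1| ≤ 40 := abs_le.2 ⟨by nlinarith, by nlinarith⟩
  have c5 : |-2 * p| ≤ 40 := abs_le.2 ⟨by nlinarith, by nlinarith⟩
  have a1 : |(p ^ 2 - p) * u + (p - 3 * p ^ 2) * u ^ 2 + p ^ 2 * u ^ 3| ≤
      40 * u + 40 * u ^ 2 + 40 * u ^ 3 := by
    refine (abs_add_three _ _ _).trans ?_
    rw [abs_mul, abs_mul, abs_mul, abs_of_pos hu, abs_of_pos (pow_pos hu 2),
      abs_of_pos (pow_pos hu 3)]
    gcongr
  have a2 : |(2 * p - 1) * u + -2 * p * u ^ 2| ≤ 40 * u + 40 * u ^ 2 := by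
    refine (abs_add_le _ _).trans ?_
    rw [abs_mul, abs_mul, abs_of_pos hu, abs_of_pos (pow_pos hu 2)]
    gcongr
  calc _ ≤ |L| * (40 * u + 40 * u ^ 2 + 40 * u ^ 3) + (40 * u + 40 * u ^ 2) := by
        refine (abs_add_le _ _).trans (add_le_add ?_ a2)
        rw [abs_mul]; gcongr
    _ ≤ _ := by
      nlinarith [mul_nonneg hl hu.le, mul_nonneg hl (pow_pos hu 2).le,
        mul_nonneg hl (pow_pos hu 3).le, pow_pos hu 2, pow_pos hu 3]

/-- The derivative `∂f(x;θ)/∂θ` of the symmetric stable density at a general `θ`. -/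
noncomputable def symStableDerivAt (θ x : ℝ) : ℝ :=
  (1 / Real.pi) * ∫ t in Ioi (0 : ℝ), Real.cos (t * x) * logProfile (2 - θ) t

lemma symStableDerivAt_zero : symStableDerivAt 0 = symStableDeriv := by
  ext x
  unfold symStableDerivAt symStableDeriv logProfile
  simp only [sub_zero, Real.rpow_two, mul_assoc]

lemma two_sub_mem_Icc {θ : ℝ} (hθ : θ ∈ Ioo (-(1 / 2) : ℝ) (1 / 2)) :
    2 - θ ∈ Icc (3 / 2 : ℝ) (5 / 2) := ⟨by linarith [hθ.2], by linarith [hθ.1]⟩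

lemma integrableOn_cos_mul_exp_neg_rpow (x : ℝ) {p : ℝ} (hp : 0 < p) :
    IntegrableOn (fun t : ℝ => Real.cos (t * x) * Real.exp (-(t ^ p))) (Ioi 0) := by
  have := integrableOn_rpow_mul_exp_neg_rpow (s := 0) (p := p) (by norm_num) hp
  refine Integrable.mono' this (by fun_prop) (Eventually.of_forall fun t => ?_)
  rw [norm_mul, Real.norm_eq_abs, Real.norm_eq_abs, abs_of_pos (Real.exp_pos _), Real.rpow_zero]
  gcongr
  exact Real.abs_cos_le_one _

lemma hasDerivAt_symStablePdf (x : ℝ) {θ : ℝ} (hθ : θ ∈ Ioo (-(1 / 2) : ℝ) (1 / 2)) :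
    HasDerivAt (symStablePdf x) (symStableDerivAt θ x) θ := by
  refine HasDerivAt.const_mul _ (hasDerivAt_integral_of_dominated_loc_of_deriv_le
    (F' := fun θ t => Real.cos (t * x) * logProfile (2 - θ) t)
    (bound := fun t => 10000 * quarticDecay t) (isOpen_Ioo.mem_nhds hθ) ?_ ?_ ?_ ?_ ?_ ?_).2
  · exact Eventually.of_forall fun θ => by fun_prop
  · exact integrableOn_cos_mul_exp_neg_rpow x (by linarith [hθ.2])
  · have := measurable_logProfile (2 - θ)
    fun_prop
  · filter_upwards [ae_restrict_mem measurableSet_Ioi] with t ht θ hθ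
    rw [norm_mul, Real.norm_eq_abs, Real.norm_eq_abs]
    exact (mul_le_of_le_one_left (abs_nonneg _) (Real.abs_cos_le_one _)).trans
      (abs_logProfile_le (two_sub_mem_Icc hθ) ht)
  · exact integrableOn_quarticDecay.const_mul _
  · filter_upwards [ae_restrict_mem measurableSet_Ioi] with t ht θ hθ
    have ht' : (0 : ℝ) < t := ht
    refine HasDerivAt.const_mul _ ?_
    have h1 : HasDerivAt (fun θ : ℝ => 2 - θ) (-1) θ := by
      simpa using (hasDerivAt_id θ).const_sub 2
    refine (h1.const_rpow ht').neg.exp.congr_deriv ?_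
    unfold logProfile
    simp only [Pi.neg_apply]
    ring

/-- A uniform constant for the quadratic decay of `∂f(x;θ)/∂θ`. -/
noncomputable def stableDerivBound : ℝ :=
  (1 / Real.pi) * (10000 * ((∫ t in Ioi (0 : ℝ), quarticDecay t) +
    ∫ t in Ioi (0 : ℝ), quarticDecay t / t ^ 2))

lemma stableDerivBound_nonneg : 0 ≤ stableDerivBound := by
  have h1 : 0 ≤ ∫ t in Ioi (0 : ℝ), quarticDecay t :=
    setIntegral_nonneg measurableSet_Ioi fun t ht => quarticDecay_nonneg (le_of_lt ht)
  have h2 : 0 ≤ ∫ t in Ioi (0 : ℝ), quarticDecay t / t ^ 2 :=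
    setIntegral_nonneg measurableSet_Ioi fun t ht =>
      div_nonneg (quarticDecay_nonneg (le_of_lt ht)) (sq_nonneg t)
  unfold stableDerivBound
  have := Real.pi_pos
  positivity

lemma abs_symStableDerivAt_le (x : ℝ) {θ : ℝ} (hθ : θ ∈ Ioo (-(1 / 2) : ℝ) (1 / 2)) :
    |symStableDerivAt θ x| ≤ stableDerivBound * (1 + x ^ 2)⁻¹ := by
  have hp := two_sub_mem_Icc hθ
  have h := abs_integral_cos_mul_le (fun t ht => hasDerivAt_logProfile (2 - θ) ht)
    (fun t ht => hasDerivAt_logProfile' (2 - θ) ht) (measurable_logProfile _)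
    (measurable_logProfile'' _) (fun t ht => abs_logProfile_le hp ht)
    (fun t ht => abs_logProfile'_le hp ht) (fun t ht => abs_logProfile''_le hp ht) x
  rw [symStableDerivAt, abs_mul, abs_of_pos (by positivity), stableDerivBound, mul_assoc (1 / _),
    ← div_eq_mul_inv]
  gcongr

lemma symStablePdf_zero (x : ℝ) :
    symStablePdf x 0 = Real.exp (-(x ^ 2 / 4)) / (2 * √Real.pi) := by
  have h := fourierIntegral_gaussian (b := 1) (by simp) (x : ℂ)
  have hre : ∫ t : ℝ, Real.cos (t * x) * Real.exp (-t ^ 2) = √Real.pi * Real.exp (-(x ^ 2 / 4)) := by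
    have e1 : ∀ t : ℝ, Real.cos (t * x) * Real.exp (-t ^ 2) =
        (Complex.exp (Complex.I * x * t) * Complex.exp (-1 * (t : ℂ) ^ 2)).re := fun t => by
      have : Complex.exp (Complex.I * x * t) * Complex.exp (-1 * (t : ℂ) ^ 2) =
          Complex.exp (((t * x : ℝ) : ℂ) * Complex.I) * ((Real.exp (-t ^ 2) : ℝ) : ℂ) := by
        push_cast
        congr 2 <;> ring
      rw [this, Complex.re_mul_ofReal, Complex.exp_ofReal_mul_I_re]
    have e2 : ((Real.pi : ℂ) / 1) ^ (1 / 2 : ℂ) * Complex.exp (-(x : ℂ) ^ 2 / (4 * 1)) =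
        ((√Real.pi * Real.exp (-(x ^ 2 / 4)) : ℝ) : ℂ) := by
      rw [Real.sqrt_eq_rpow]
      push_cast
      rw [Complex.ofReal_cpow Real.pi_pos.le]
      push_cast
      simp only [div_one, mul_one, neg_div]
    have hint : Integrable fun t : ℝ =>
        Complex.exp (Complex.I * x * t) * Complex.exp (-1 * (t : ℂ) ^ 2) := by
      by_contra hc
      rw [integral_undef hc, e2] at h
      have : (0 : ℝ) < √Real.pi * Real.exp (-(x ^ 2 / 4)) := by
        have := Real.pi_pos
        positivity
      exact this.ne (by exact_mod_cast h)
    simp_rw [e1]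
    rw [show (∫ t : ℝ, (Complex.exp (Complex.I * x * t) * Complex.exp (-1 * (t : ℂ) ^ 2)).re) =
      (∫ t : ℝ, Complex.exp (Complex.I * x * t) * Complex.exp (-1 * (t : ℂ) ^ 2)).re from
        integral_re hint, h, e2, Complex.ofReal_re]
  have habs := integral_comp_abs (f := fun t => Real.cos (t * x) * Real.exp (-t ^ 2))
  have e3 : ∀ t : ℝ, Real.cos (|t| * x) * Real.exp (-|t| ^ 2) =
      Real.cos (t * x) * Real.exp (-t ^ 2) := fun t => by
    rw [sq_abs]
    rcases abs_choice t with ht | ht <;> rw [ht]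
    rw [neg_mul, Real.cos_neg]
  simp only [e3] at habs
  rw [hre] at habs
  unfold symStablePdf
  simp only [sub_zero, Real.rpow_two]
  have hs : √Real.pi ≠ 0 := (Real.sqrt_pos.2 Real.pi_pos).ne'
  have hpi : Real.pi = √Real.pi * √Real.pi := (Real.mul_self_sqrt Real.pi_pos.le).symm
  rw [show (∫ t in Ioi (0 : ℝ), Real.cos (t * x) * Real.exp (-t ^ 2)) =
    √Real.pi * Real.exp (-(x ^ 2 / 4)) / 2 by linarith]
  generalize √Real.pi = r at *
  rw [hpi]
  field_simp

lemma symStablePdf_zero_pos (x : ℝ) : 0 < symStablePdf x 0 := by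
  rw [symStablePdf_zero]
  have := Real.pi_pos
  positivity

lemma symStablePdf_zero_le (x : ℝ) : symStablePdf x 0 ≤ 4 * (1 + x ^ 2)⁻¹ := by
  have h1 : Real.exp (-(x ^ 2 / 4)) ≤ 4 * (1 + x ^ 2)⁻¹ := by
    rw [Real.exp_neg, ← div_eq_mul_inv, inv_eq_one_div, div_le_div_iff₀ (Real.exp_pos _)
      (by positivity)]
    linarith [Real.add_one_le_exp (x ^ 2 / 4)]
  have h2 : 1 ≤ √Real.pi := Real.one_le_sqrt.2 (by linarith [Real.pi_gt_three])
  rw [symStablePdf_zero]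
  exact (div_le_self (Real.exp_pos _).le (by linarith)).trans h1

lemma abs_symStablePdf_le (x : ℝ) {θ : ℝ} (hθ : θ ∈ Ioo (-(1 / 2) : ℝ) (1 / 2)) :
    |symStablePdf x θ| ≤ (stableDerivBound + 4) * (1 + x ^ 2)⁻¹ := by
  have h := (convex_Ioo (-(1 / 2) : ℝ) (1 / 2)).norm_image_sub_le_of_norm_hasDerivWithin_le
    (fun θ hθ => (hasDerivAt_symStablePdf x hθ).hasDerivWithinAt)
    (fun θ hθ => abs_symStableDerivAt_le x hθ) (x := 0) (y := θ) (by norm_num) hθ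
  have h0 := symStablePdf_zero_le x
  have hb : 0 ≤ stableDerivBound * (1 + x ^ 2)⁻¹ :=
    mul_nonneg stableDerivBound_nonneg (by positivity)
  have hθ1 : |θ| ≤ 1 := abs_le.2 ⟨by linarith [hθ.1], by linarith [hθ.2]⟩
  simp only [Real.norm_eq_abs, sub_zero] at h
  have h3 := (abs_sub_abs_le_abs_sub (symStablePdf x θ) (symStablePdf x 0)).trans
    (h.trans (mul_le_of_le_one_right hb hθ1))
  rw [abs_of_pos (symStablePdf_zero_pos x)] at h3
  linarith

lemma measurable_symStablePdf (θ : ℝ) : Measurable fun x => symStablePdf x θ := by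
  refine Measurable.const_mul ?_ _
  refine (StronglyMeasurable.integral_prod_right (ν := volume.restrict (Ioi (0 : ℝ)))
    (f := fun x t => Real.cos (t * x) * Real.exp (-(t ^ (2 - θ)))) ?_).measurable
  exact Measurable.stronglyMeasurable (by unfold Function.uncurry; fun_prop)

lemma measurable_symStableDerivAt (θ : ℝ) : Measurable (symStableDerivAt θ) := by
  refine Measurable.const_mul ?_ _
  have hm := measurable_logProfile (2 - θ)
  refine (StronglyMeasurable.integral_prod_right (ν := volume.restrict (Ioi (0 : ℝ)))
    (f := fun x t => Real.cos (t * x) * logProfile (2 - θ) t) ?_).measurable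
  exact Measurable.stronglyMeasurable (by unfold Function.uncurry; fun_prop)

lemma zero_mem_Ioo_half : (0 : ℝ) ∈ Ioo (-(1 / 2) : ℝ) (1 / 2) := by norm_num

lemma integrable_symStablePdf {θ : ℝ} (hθ : θ ∈ Ioo (-(1 / 2) : ℝ) (1 / 2)) :
    Integrable fun x => symStablePdf x θ :=
  Integrable.mono' (integrable_inv_one_add_sq.const_mul (stableDerivBound + 4))
    (measurable_symStablePdf θ).aestronglyMeasurable
    (Eventually.of_forall fun x => abs_symStablePdf_le x hθ)

/-- The `θ`-derivative at `θ = 0` of the joint density. -/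
noncomputable def jointScore (n : ℕ) (x : Fin n → ℝ) : ℝ :=
  (∑ i, symStableDeriv (x i) / symStablePdf (x i) 0) * ∏ j, symStablePdf (x j) 0

lemma jointScore_eq (n : ℕ) (x : Fin n → ℝ) : jointScore n x =
    ∑ i, (∏ j ∈ Finset.univ.erase i, symStablePdf (x j) 0) • symStableDerivAt 0 (x i) := by
  rw [jointScore, Finset.sum_mul, symStableDerivAt_zero]
  refine Finset.sum_congr rfl fun i _ => ?_
  rw [← Finset.mul_prod_erase _ _ (Finset.mem_univ i), smul_eq_mul, ← mul_assoc,
    div_mul_cancel₀ _ (symStablePdf_zero_pos _).ne', mul_comm]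

lemma measurable_jointScore (n : ℕ) : Measurable (jointScore n) := by
  have h1 := measurable_symStablePdf 0
  have h2 : Measurable symStableDeriv := symStableDerivAt_zero ▸ measurable_symStableDerivAt 0
  unfold jointScore
  fun_prop

lemma hasDerivAt_setIntegral_prod_symStablePdf (n : ℕ) (R : Set (Fin n → ℝ)) :
    IntegrableOn (jointScore n) R ∧
      HasDerivAt (fun θ => ∫ x in R, ∏ i, symStablePdf (x i) θ)
        (∫ x in R, jointScore n x) 0 := by
  have hfun : jointScore n = fun x => ∑ i,
    (∏ j ∈ Finset.univ.erase i, symStablePdf (x j) 0) • symStableDerivAt 0 (x i) :=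
    funext (jointScore_eq n)
  have hmeas := (measurable_jointScore n).aestronglyMeasurable (μ := volume.restrict R)
  rw [hfun] at hmeas ⊢
  set M := stableDerivBound + 4
  have hM : 0 ≤ M := by have := stableDerivBound_nonneg; positivity
  refine hasDerivAt_integral_of_dominated_loc_of_deriv_le
    (F' := fun θ (x : Fin n → ℝ) =>
      ∑ i, (∏ j ∈ Finset.univ.erase i, symStablePdf (x j) θ) • symStableDerivAt θ (x i))
    (bound := fun x => n * ∏ i, M * (1 + x i ^ 2)⁻¹)
    (isOpen_Ioo.mem_nhds zero_mem_Ioo_half) ?_ ?_ ?_ ?_ ?_ ?_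
  · refine Eventually.of_forall fun θ => ?_
    have := measurable_symStablePdf θ
    exact Measurable.aestronglyMeasurable (by fun_prop)
  · exact (Integrable.fintype_prod (fun _ => integrable_symStablePdf zero_mem_Ioo_half)).integrableOn
  · exact hmeas
  · refine Eventually.of_forall fun x θ hθ => ?_
    calc _ ≤ ∑ i : Fin n, ∏ i, M * (1 + x i ^ 2)⁻¹ := by
          refine norm_sum_le_of_le _ fun i _ => ?_
          rw [norm_smul, norm_prod, ← Finset.prod_erase_mul _ _ (Finset.mem_univ i)]
          gcongr with j hj
          · exact abs_symStablePdf_le (x j) hθ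
          · refine (abs_symStableDerivAt_le (x i) hθ).trans ?_
            gcongr
            exact le_add_of_nonneg_right (by norm_num)
      _ = _ := by simp
  · exact ((Integrable.fintype_prod
      (fun _ => integrable_inv_one_add_sq.const_mul M)).const_mul _).integrableOn
  · refine Eventually.of_forall fun x θ hθ => ?_
    exact HasDerivAt.fun_finsetProd fun i _ => hasDerivAt_symStablePdf (x i) hθ

/-- The joint null density. -/
noncomputable def jointPdf (n : ℕ) (x : Fin n → ℝ) : ℝ := ∏ j, symStablePdf (x j) 0

/-- The normalising constant of the joint null density. -/
noncomputable def jointConst (n : ℕ) : ℝ := ((2 * √Real.pi)⁻¹) ^ n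

lemma jointConst_pos (n : ℕ) : 0 < jointConst n := by
  have := Real.pi_pos
  unfold jointConst
  positivity

lemma jointPdf_eq (n : ℕ) (x : Fin n → ℝ) :
    jointPdf n x = jointConst n * Real.exp (-(∑ i, x i ^ 2) / 4) := by
  simp only [jointPdf, symStablePdf_zero, div_eq_mul_inv (Real.exp _), Finset.prod_mul_distrib,
    Finset.prod_const, Finset.card_univ, Fintype.card_fin, ← Real.exp_sum, jointConst]
  rw [mul_comm, Finset.sum_neg_distrib, ← Finset.sum_div, neg_div]

lemma jointPdf_pos (n : ℕ) (x : Fin n → ℝ) : 0 < jointPdf n x :=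
  Finset.prod_pos fun _ _ => symStablePdf_zero_pos _

lemma measurable_jointPdf (n : ℕ) : Measurable (jointPdf n) := by
  have := measurable_symStablePdf 0
  unfold jointPdf
  fun_prop

lemma integrable_jointPdf (n : ℕ) : Integrable (jointPdf n) :=
  Integrable.fintype_prod fun _ => integrable_symStablePdf zero_mem_Ioo_half

lemma sampSD_nonneg (n : ℕ) (x : Fin n → ℝ) : 0 ≤ sampSD n x := Real.sqrt_nonneg _

lemma measurable_sampMean (n : ℕ) : Measurable (sampMean n) := by
  unfold sampMean; fun_prop

lemma measurable_sampSD (n : ℕ) : Measurable (sampSD n) := by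
  have := measurable_sampMean n
  unfold sampSD; fun_prop

lemma sampMean_affine {n : ℕ} (hn : n ≠ 0) (a b : ℝ) (x : Fin n → ℝ) :
    sampMean n (fun i => a + b * x i) = a + b * sampMean n x := by
  have : (n : ℝ) ≠ 0 := by exact_mod_cast hn
  simp only [sampMean, Finset.sum_add_distrib, ← Finset.mul_sum, Finset.sum_const,
    Finset.card_univ, Fintype.card_fin, nsmul_eq_mul]
  field_simp

lemma sampSD_affine {n : ℕ} (hn : n ≠ 0) (a : ℝ) {b : ℝ} (hb : 0 < b) (x : Fin n → ℝ) :
    sampSD n (fun i => a + b * x i) = b * sampSD n x := by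
  have : ∀ i, (a + b * x i - (a + b * sampMean n x)) ^ 2 = b ^ 2 * (x i - sampMean n x) ^ 2 :=
    fun i => by ring
  rw [sampSD, sampSD, sampMean_affine hn]
  simp only [this]
  rw [← Finset.mul_sum, mul_div_assoc, Real.sqrt_mul (sq_nonneg b), Real.sqrt_sq hb.le]

lemma stdized_affine {n : ℕ} (hn : n ≠ 0) (a : ℝ) {b : ℝ} (hb : 0 < b) (x : Fin n → ℝ) :
    stdized n (fun i => a + b * x i) = stdized n x := by
  ext i
  rw [stdized, stdized, sampSD_affine hn a hb, sampMean_affine hn,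
    ← mul_div_mul_left _ (sampSD n x) hb.ne']
  ring_nf

lemma sum_stdized (n : ℕ) (x : Fin n → ℝ) : ∑ i, stdized n x i = 0 := by
  rcases eq_or_ne n 0 with rfl | hn
  · simp
  have : (n : ℝ) ≠ 0 := by exact_mod_cast hn
  simp only [stdized, ← Finset.sum_div, Finset.sum_sub_distrib, Finset.sum_const,
    Finset.card_univ, Fintype.card_fin, nsmul_eq_mul, sampMean]
  rw [mul_div_cancel_left₀ _ this, sub_self, zero_div]

lemma sum_stdized_sq {n : ℕ} (hn : n ≠ 0) {x : Fin n → ℝ} (hx : 0 < sampSD n x) :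
    ∑ i, stdized n x i ^ 2 = n := by
  have hn' : (n : ℝ) ≠ 0 := by exact_mod_cast hn
  have hs : sampSD n x ^ 2 = (∑ i, (x i - sampMean n x) ^ 2) / n :=
    Real.sq_sqrt (div_nonneg (Finset.sum_nonneg fun _ _ => sq_nonneg _) (Nat.cast_nonneg n))
  simp only [stdized, div_pow, ← Finset.sum_div]
  rw [div_eq_iff (pow_pos hx 2).ne', hs, mul_div_cancel₀ _ hn']

lemma eq_mean_add_sd_mul_stdized {n : ℕ} {x : Fin n → ℝ} (hx : 0 < sampSD n x) (i : Fin n) :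
    x i = sampMean n x + sampSD n x * stdized n x i := by
  rw [stdized, mul_div_cancel₀ _ hx.ne']
  ring

lemma sum_sq_affine {n : ℕ} {z : Fin n → ℝ} (h1 : ∑ i, z i = 0) (h2 : ∑ i, z i ^ 2 = n)
    (a b : ℝ) : ∑ i, (a + b * z i) ^ 2 = n * (a ^ 2 + b ^ 2) := by
  have : ∀ i, (a + b * z i) ^ 2 = a ^ 2 + 2 * a * b * z i + b ^ 2 * z i ^ 2 := fun i => by ring
  simp only [this, Finset.sum_add_distrib, ← Finset.mul_sum, h1, h2, Finset.sum_const,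
    Finset.card_univ, Fintype.card_fin, nsmul_eq_mul]
  ring

lemma jointPdf_affine {n : ℕ} {z : Fin n → ℝ} (h1 : ∑ i, z i = 0) (h2 : ∑ i, z i ^ 2 = n)
    (a b : ℝ) : jointPdf n (fun i => a + b * z i) =
      jointConst n * Real.exp (-((n : ℝ) * (a ^ 2 + b ^ 2)) / 4) := by
  rw [jointPdf_eq, sum_sq_affine h1 h2]

lemma ae_sampSD_pos {n : ℕ} (hn : 2 ≤ n) : ∀ᵐ x : Fin n → ℝ, 0 < sampSD n x := by
  let i : Fin n := ⟨0, by omega⟩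
  let j : Fin n := ⟨1, by omega⟩
  have hij : i ≠ j := by simp [i, j]
  let V : Submodule ℝ (Fin n → ℝ) :=
    LinearMap.ker (LinearMap.proj (R := ℝ) (φ := fun _ : Fin n => ℝ) i - LinearMap.proj j)
  have hV : V ≠ ⊤ := by
    intro h
    have : Pi.single i (1 : ℝ) ∈ V := h ▸ Submodule.mem_top
    simp [V, hij] at this
  refine measure_mono_null (fun x hx => ?_) (Measure.addHaar_submodule volume V hV)
  have hs : sampSD n x = 0 := le_antisymm (not_lt.1 hx) (sampSD_nonneg n x)
  have hn0 : (0 : ℝ) < n := by exact_mod_cast (by omega : 0 < n)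
  rw [sampSD, Real.sqrt_eq_zero (div_nonneg (Finset.sum_nonneg fun _ _ => sq_nonneg _) hn0.le),
    div_eq_zero_iff, or_iff_left hn0.ne',
    Finset.sum_eq_zero_iff_of_nonneg fun _ _ => sq_nonneg _] at hs
  have e : ∀ l, x l = sampMean n x := fun l => by
    have := hs l (Finset.mem_univ l)
    exact sub_eq_zero.1 (pow_eq_zero_iff (two_ne_zero) |>.1 this)
  simp [V, e i, e j]

/-- Scaling of the Lebesgue integral over the half line. -/
lemma lintegral_Ioi_scale (F : ℝ → ENNReal) {s : ℝ} (hs : 0 < s) :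
    ∫⁻ b in Ioi (0 : ℝ), F b = ENNReal.ofReal s * ∫⁻ b in Ioi (0 : ℝ), F (s * b) := by
  have h := Real.smul_map_volume_mul_left hs.ne'
  have he : MeasurableEmbedding (fun b : ℝ => s * b) := measurableEmbedding_mulLeft₀ hs.ne'
  rw [← lintegral_indicator measurableSet_Ioi, ← lintegral_indicator measurableSet_Ioi]
  conv_lhs => rw [← h]
  rw [lintegral_smul_measure, he.lintegral_map, abs_of_pos hs, smul_eq_mul]
  congr 2 with b
  simp [indicator, hs]

/-- Scaling and translation of the Lebesgue integral over the line. -/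
lemma lintegral_affine (F : ℝ → ENNReal) (m : ℝ) {s : ℝ} (hs : 0 < s) :
    ∫⁻ a, F a = ENNReal.ofReal s * ∫⁻ a, F (m + s * a) := by
  have h := Real.smul_map_volume_mul_left hs.ne'
  have he : MeasurableEmbedding (fun b : ℝ => s * b) := measurableEmbedding_mulLeft₀ hs.ne'
  rw [← lintegral_add_left_eq_self _ m]
  conv_lhs => rw [← h]
  rw [lintegral_smul_measure, he.lintegral_map, abs_of_pos hs, smul_eq_mul]

/-- Scaling and translation by a common scalar of the Lebesgue integral on `ℝⁿ`. -/
lemma lintegral_pi_affine {n : ℕ} (Q : (Fin n → ℝ) → ENNReal) (a : ℝ) {b : ℝ} (hb : 0 < b) :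
    ∫⁻ x : Fin n → ℝ, Q (fun i => a + b * x i) = ENNReal.ofReal ((b ^ n)⁻¹) * ∫⁻ y, Q y := by
  have h := Measure.map_addHaar_smul (volume : Measure (Fin n → ℝ)) hb.ne'
  have he : MeasurableEmbedding (fun x : Fin n → ℝ => b • x) :=
    (Homeomorph.smulOfNeZero b hb.ne').measurableEmbedding
  have : ∫⁻ x : Fin n → ℝ, Q (fun i => a + b * x i) =
      ∫⁻ y, Q ((fun _ => a) + y) ∂(Measure.map (fun x : Fin n → ℝ => b • x) volume) := by
    rw [he.lintegral_map]
    rfl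
  rw [this, h, lintegral_smul_measure, lintegral_add_left_eq_self, smul_eq_mul,
    Module.finrank_fin_fun, abs_of_pos (by positivity)]

/-- The weight on the orbit parameters and the sample that makes the affine action push forward to
a multiple of Lebesgue measure. -/
noncomputable def orbitWeight (n : ℕ) (b : ℝ) (x : Fin n → ℝ) : ℝ :=
  b ^ (n - 2) * (sampSD n x ^ (n - 1) * jointPdf n x)

lemma orbitWeight_nonneg (n : ℕ) {b : ℝ} (hb : 0 ≤ b) (x : Fin n → ℝ) : 0 ≤ orbitWeight n b x :=
  mul_nonneg (pow_nonneg hb _)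
    (mul_nonneg (pow_nonneg (sampSD_nonneg n x) _) (jointPdf_pos n x).le)

/-- The proportionality constant for the pushforward of the orbit weight. -/
noncomputable def orbitConst (n : ℕ) : ENNReal :=
  ∫⁻ b in Ioi (0 : ℝ), ∫⁻ a : ℝ, ENNReal.ofReal
    (jointConst n * (b ^ n)⁻¹ * b ^ (n - 2) * (b ^ (n - 1))⁻¹ *
      Real.exp (-((n : ℝ) * ((a / b) ^ 2 + (1 / b) ^ 2)) / 4))

lemma orbitConst_ne_zero (n : ℕ) : orbitConst n ≠ 0 := by
  unfold orbitConst
  have hp : ∀ b : ℝ, 0 < b → ∀ a : ℝ, 0 < ENNReal.ofReal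
    (jointConst n * (b ^ n)⁻¹ * b ^ (n - 2) * (b ^ (n - 1))⁻¹ *
      Real.exp (-((n : ℝ) * ((a / b) ^ 2 + (1 / b) ^ 2)) / 4)) := fun b hb a => by
    have := jointConst_pos n
    rw [ENNReal.ofReal_pos]
    positivity
  have hm : Measurable (Function.uncurry fun b a : ℝ => ENNReal.ofReal
    (jointConst n * (b ^ n)⁻¹ * b ^ (n - 2) * (b ^ (n - 1))⁻¹ *
      Real.exp (-((n : ℝ) * ((a / b) ^ 2 + (1 / b) ^ 2)) / 4))) := by
    unfold Function.uncurry; fun_prop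
  have h1 : ∀ b : ℝ, 0 < b → (∫⁻ a : ℝ, ENNReal.ofReal
    (jointConst n * (b ^ n)⁻¹ * b ^ (n - 2) * (b ^ (n - 1))⁻¹ *
      Real.exp (-((n : ℝ) * ((a / b) ^ 2 + (1 / b) ^ 2)) / 4))) ≠ 0 := fun b hb h => by
    rw [lintegral_eq_zero_iff hm.of_uncurry_left] at h
    obtain ⟨a, ha⟩ := h.exists
    exact (hp b hb a).ne' ha
  intro h
  rw [lintegral_eq_zero_iff hm.lintegral_prod_right] at h
  have := (h.and (ae_restrict_mem measurableSet_Ioi))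
  have hne : NeBot (ae (volume.restrict (Ioi (0 : ℝ)))) := by
    rw [ae_neBot]; simp
  obtain ⟨b, hb, hb0⟩ := this.exists
  exact h1 b hb0 hb

lemma inv_pow_mul_exp_le {n : ℕ} (hn : 2 ≤ n) : ∃ C : ℝ, ∀ b : ℝ, 0 < b →
    (b ^ n)⁻¹ * Real.exp (-((n : ℝ) * (1 / b) ^ 2) / 4) ≤ C * (1 + b ^ 2)⁻¹ := by
  have hn0 : (0 : ℝ) < n := by exact_mod_cast (by omega : 0 < n)
  refine ⟨2 * (n.factorial * (4 / n) ^ n) + 2, fun b hb => ?_⟩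
  have hA : 0 ≤ n.factorial * (4 / n : ℝ) ^ n := by positivity
  have hexp : Real.exp (-((n : ℝ) * (1 / b) ^ 2) / 4) ≤ 1 :=
    Real.exp_le_one_iff.2 (by have : 0 ≤ (n : ℝ) * (1 / b) ^ 2 := by positivity
                              linarith)
  rcases le_total b 1 with h | h
  · have h1 : (b ^ n)⁻¹ * Real.exp (-((n : ℝ) * (1 / b) ^ 2) / 4) ≤
        n.factorial * (4 / n : ℝ) ^ n := by
      have h2 := Real.pow_div_factorial_le_exp ((n : ℝ) * (1 / b) ^ 2 / 4) (by positivity) n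
      rw [div_le_iff₀ (by positivity)] at h2
      have h3 : (b ^ n)⁻¹ ≤ ((1 / b) ^ 2) ^ n := by
        rw [← inv_pow, ← one_div]
        have : 1 ≤ 1 / b := (one_le_div hb).2 h
        gcongr
        nlinarith
      rw [neg_div, Real.exp_neg, ← div_eq_mul_inv, div_le_iff₀ (Real.exp_pos _)]
      calc _ ≤ ((1 / b) ^ 2) ^ n := h3
        _ = (4 / n : ℝ) ^ n * ((n : ℝ) * (1 / b) ^ 2 / 4) ^ n := by
            rw [← mul_pow]; congr 1; field_simp
        _ ≤ (4 / n : ℝ) ^ n * (Real.exp ((n : ℝ) * (1 / b) ^ 2 / 4) * n.factorial) := by gcongr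
        _ = _ := by ring
    refine h1.trans ?_
    rw [← div_eq_mul_inv, le_div_iff₀ (by positivity)]
    have : b ^ 2 ≤ 1 := pow_le_one₀ hb.le h
    nlinarith
  · have h1 : (b ^ n)⁻¹ ≤ (b ^ 2)⁻¹ := by gcongr
    refine (mul_le_of_le_one_right (by positivity) hexp).trans (h1.trans ?_)
    rw [← div_eq_mul_inv, inv_eq_one_div, div_le_div_iff₀ (by positivity) (by positivity)]
    have : 1 ≤ b ^ 2 := one_le_pow₀ h
    nlinarith

lemma orbitConst_ne_top {n : ℕ} (hn : 3 ≤ n) : orbitConst n ≠ ⊤ := by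
  have hn0 : (0 : ℝ) < n := by exact_mod_cast (by omega : 0 < n)
  obtain ⟨C, hC⟩ := inv_pow_mul_exp_le (n := n) (by omega)
  have hJ := jointConst_pos n
  set κ : ℝ := jointConst n * √(Real.pi / (n / 4)) with hκ
  have h1 : ∀ b : ℝ, 0 < b → (∫⁻ a : ℝ, ENNReal.ofReal
      (jointConst n * (b ^ n)⁻¹ * b ^ (n - 2) * (b ^ (n - 1))⁻¹ *
        Real.exp (-((n : ℝ) * ((a / b) ^ 2 + (1 / b) ^ 2)) / 4))) ≤
      ENNReal.ofReal (κ * (C * (1 + b ^ 2)⁻¹)) := fun b hb => by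
    have hβ : 0 < (n : ℝ) / 4 := by positivity
    rw [lintegral_affine _ 0 hb]
    have e : ∀ a : ℝ, jointConst n * (b ^ n)⁻¹ * b ^ (n - 2) * (b ^ (n - 1))⁻¹ *
        Real.exp (-((n : ℝ) * (((0 + b * a) / b) ^ 2 + (1 / b) ^ 2)) / 4) =
        (jointConst n * b⁻¹ * ((b ^ n)⁻¹ * Real.exp (-((n : ℝ) * (1 / b) ^ 2) / 4))) *
          Real.exp (-(n / 4) * a ^ 2) := fun a => by
      have e1 : b ^ (n - 2) * (b ^ (n - 1))⁻¹ = b⁻¹ := by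
        rw [show n - 1 = (n - 2) + 1 by omega, pow_succ]
        field_simp
      have e2 : Real.exp (-((n : ℝ) * (((0 + b * a) / b) ^ 2 + (1 / b) ^ 2)) / 4) =
          Real.exp (-((n : ℝ) * (1 / b) ^ 2) / 4) * Real.exp (-(n / 4) * a ^ 2) := by
        rw [← Real.exp_add, zero_add, mul_div_cancel_left₀ _ hb.ne']
        congr 1
        ring
      rw [mul_assoc (jointConst n * _), e1, e2]
      ring
    simp only [e]
    rw [← ofReal_integral_eq_lintegral_ofReal ((integrable_exp_neg_mul_sq hβ).const_mul _)
      (Eventually.of_forall fun a => by positivity), integral_const_mul, integral_gaussian,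
      ← ENNReal.ofReal_mul hb.le]
    refine ENNReal.ofReal_le_ofReal ?_
    calc _ = κ * ((b ^ n)⁻¹ * Real.exp (-((n : ℝ) * (1 / b) ^ 2) / 4)) := by
          rw [hκ]; field_simp
      _ ≤ _ := mul_le_mul_of_nonneg_left (hC b hb) (by positivity)
  have hfin : Integrable (fun b : ℝ => κ * (C * (1 + b ^ 2)⁻¹)) (volume.restrict (Ioi 0)) :=
    ((integrable_inv_one_add_sq.const_mul C).const_mul κ).integrableOn
  refine ne_of_lt (lt_of_le_of_lt ?_ hfin.lintegral_lt_top)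
  exact setLIntegral_mono' measurableSet_Ioi h1

lemma lintegral_orbit {n : ℕ} (hn : 3 ≤ n) {q : (Fin n → ℝ) → ENNReal} (hq : Measurable q) :
    ∫⁻ b in Ioi (0 : ℝ), ∫⁻ a : ℝ, ∫⁻ x : Fin n → ℝ,
      ENNReal.ofReal (orbitWeight n b x) * q (fun i => a + b * x i) =
        orbitConst n * ∫⁻ y, q y := by
  have hn0 : n ≠ 0 := by omega
  have hSD := measurable_sampSD n
  have hpdf := measurable_jointPdf n
  let Φ : ℝ → ℝ → (Fin n → ℝ) → ℝ := fun b a y =>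
    (b ^ n)⁻¹ * orbitWeight n b (fun i => -a / b + b⁻¹ * y i)
  have hΦ : Measurable fun p : ℝ × ℝ × (Fin n → ℝ) => ENNReal.ofReal (Φ p.1 p.2.1 p.2.2) := by
    simp only [Φ, orbitWeight]
    fun_prop
  have h1 : ∀ b : ℝ, 0 < b → ∀ a : ℝ, ∫⁻ x : Fin n → ℝ,
      ENNReal.ofReal (orbitWeight n b x) * q (fun i => a + b * x i) =
        ∫⁻ y, ENNReal.ofReal (Φ b a y) * q y := fun b hb a => by
    have := lintegral_pi_affine
      (fun y => ENNReal.ofReal (orbitWeight n b (fun i => -a / b + b⁻¹ * y i)) * q y) a hb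
    rw [← lintegral_const_mul' _ _ ENNReal.ofReal_ne_top] at this
    convert this using 2
    · ext x
      congr 4
      ext i
      field_simp
      ring
    · ext y
      rw [← mul_assoc, ← ENNReal.ofReal_mul (by positivity)]
  have h2 : ∀ y : Fin n → ℝ, 0 < sampSD n y →
      ∫⁻ b in Ioi (0 : ℝ), ∫⁻ a : ℝ, ENNReal.ofReal (Φ b a y) = orbitConst n := fun y hy => by
    set s := sampSD n y
    rw [lintegral_Ioi_scale _ hy, ← lintegral_const_mul' _ _ ENNReal.ofReal_ne_top]
    refine setLIntegral_congr_fun measurableSet_Ioi fun b hb => ?_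
    have hb : 0 < b := hb
    rw [lintegral_affine _ (sampMean n y) hy, ← lintegral_const_mul' _ _ ENNReal.ofReal_ne_top,
      ← lintegral_const_mul' _ _ ENNReal.ofReal_ne_top]
    refine lintegral_congr fun a => ?_
    rw [← ENNReal.ofReal_mul hy.le, ← ENNReal.ofReal_mul hy.le]
    congr 1
    have e1 : (fun i => -(sampMean n y + s * a) / (s * b) + (s * b)⁻¹ * y i) =
        fun i => -(a / b) + 1 / b * stdized n y i := by
      ext i
      conv_lhs => rw [eq_mean_add_sd_mul_stdized hy i]
      have : sampSD n y = s := rfl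
      rw [this]
      field_simp
      ring
    have hsd : sampSD n (fun i => -(sampMean n y + s * a) / (s * b) + (s * b)⁻¹ * y i) = b⁻¹ := by
      rw [sampSD_affine hn0 _ (by positivity)]
      field_simp
      rfl
    have e2 : s ^ n = s ^ (n - 2) * s * s := by
      rw [mul_assoc, ← pow_two, ← pow_add]; congr 1; omega
    simp only [Φ, orbitWeight]
    rw [hsd, e1, jointPdf_affine (sum_stdized n y) (sum_stdized_sq hn0 hy), neg_sq, mul_pow,
      mul_pow, e2, inv_pow]
    field_simp
  calc _ = ∫⁻ b in Ioi (0 : ℝ), ∫⁻ a : ℝ, ∫⁻ y, ENNReal.ofReal (Φ b a y) * q y := by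
        refine setLIntegral_congr_fun measurableSet_Ioi fun b hb => lintegral_congr fun a => ?_
        exact h1 b hb a
    _ = ∫⁻ b in Ioi (0 : ℝ), ∫⁻ y, ∫⁻ a : ℝ, ENNReal.ofReal (Φ b a y) * q y := by
        refine lintegral_congr fun b => lintegral_lintegral_swap ?_
        exact ((hΦ.comp (show Measurable fun p : ℝ × (Fin n → ℝ) => (b, p.1, p.2) by
          fun_prop)).mul (hq.comp measurable_snd)).aemeasurable
    _ = ∫⁻ y, ∫⁻ b in Ioi (0 : ℝ), ∫⁻ a : ℝ, ENNReal.ofReal (Φ b a y) * q y := by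
        refine lintegral_lintegral_swap (Measurable.aemeasurable ?_)
        refine Measurable.lintegral_prod_right' (f := fun p : (ℝ × (Fin n → ℝ)) × ℝ =>
          ENNReal.ofReal (Φ p.1.1 p.2 p.1.2) * q p.1.2) (Measurable.mul ?_ (by fun_prop))
        exact hΦ.comp (g := _) (f := fun p : (ℝ × (Fin n → ℝ)) × ℝ => (p.1.1, p.2, p.1.2))
          (by fun_prop)
    _ = ∫⁻ y, orbitConst n * q y := by
        refine lintegral_congr_ae ?_
        filter_upwards [ae_sampSD_pos (n := n) (by omega)] with y hy
        rw [← h2 y hy]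
        have m1 : Measurable fun p : ℝ × ℝ => ENNReal.ofReal (Φ p.1 p.2 y) :=
          hΦ.comp (f := fun p : ℝ × ℝ => (p.1, p.2, y)) (by fun_prop)
        rw [← lintegral_mul_const _ m1.lintegral_prod_right']
        exact lintegral_congr fun b => lintegral_mul_const _ (m1.comp measurable_prodMk_left)
    _ = _ := lintegral_const_mul _ hq

/-- Lebesgue measure on the half plane of orbit parameters `(b, a)`, `b > 0`. -/
noncomputable def orbitMeasure : Measure (ℝ × ℝ) := (volume.restrict (Ioi (0 : ℝ))).prod volume

instance : SFinite orbitMeasure := by unfold orbitMeasure; infer_instance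

/-- The affine action `(b, a) • x = a + b x`. -/
def orbitMap (n : ℕ) (p : (ℝ × ℝ) × (Fin n → ℝ)) : Fin n → ℝ := fun i => p.1.2 + p.1.1 * p.2 i

lemma measurable_orbitMap (n : ℕ) : Measurable (orbitMap n) := by
  unfold orbitMap; fun_prop

lemma measurable_orbitWeight (n : ℕ) :
    Measurable fun p : (ℝ × ℝ) × (Fin n → ℝ) => orbitWeight n p.1.1 p.2 := by
  have hSD := measurable_sampSD n
  have hpdf := measurable_jointPdf n
  unfold orbitWeight
  fun_prop

lemma ae_orbit_pos (n : ℕ) :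
    ∀ᵐ p : (ℝ × ℝ) × (Fin n → ℝ) ∂(orbitMeasure.prod volume), 0 < p.1.1 := by
  have h : ∀ᵐ b : ℝ ∂(volume.restrict (Ioi (0 : ℝ))), 0 < b := ae_restrict_mem measurableSet_Ioi
  have h2 : ∀ᵐ p : ℝ × ℝ ∂orbitMeasure, 0 < p.1 := Measure.quasiMeasurePreserving_fst.ae h
  exact Measure.quasiMeasurePreserving_fst.ae h2

lemma map_orbitMap {n : ℕ} (hn : 3 ≤ n) :
    Measure.map (orbitMap n) ((orbitMeasure.prod volume).withDensity
      fun p => ENNReal.ofReal (orbitWeight n p.1.1 p.2)) = orbitConst n • volume := by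
  refine Measure.ext_of_lintegral _ fun q hq => ?_
  have hw := (measurable_orbitWeight n).ennreal_ofReal
  have hqm : Measurable fun p => q (orbitMap n p) := hq.comp (measurable_orbitMap n)
  rw [lintegral_map hq (measurable_orbitMap n),
    lintegral_withDensity_eq_lintegral_mul _ hw hqm, lintegral_smul_measure, smul_eq_mul,
    ← lintegral_orbit hn hq, lintegral_prod _ (hw.mul hqm).aemeasurable, orbitMeasure,
    lintegral_prod _ (hw.mul hqm).lintegral_prod_right'.aemeasurable]
  rfl

lemma integral_orbit {n : ℕ} (hn : 3 ≤ n) {g : (Fin n → ℝ) → ℝ} (hg : Integrable g) :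
    Integrable (fun p => orbitWeight n p.1.1 p.2 * g (orbitMap n p)) (orbitMeasure.prod volume) ∧
      ∫ p, orbitWeight n p.1.1 p.2 * g (orbitMap n p) ∂(orbitMeasure.prod volume) =
        (orbitConst n).toReal * ∫ y, g y := by
  have hw := (measurable_orbitWeight n).ennreal_ofReal
  have hm := (measurable_orbitMap n).aemeasurable (μ := (orbitMeasure.prod volume).withDensity
      fun p => ENNReal.ofReal (orbitWeight n p.1.1 p.2))
  have hlt : ∀ᵐ p : (ℝ × ℝ) × (Fin n → ℝ) ∂(orbitMeasure.prod volume),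
      ENNReal.ofReal (orbitWeight n p.1.1 p.2) < ⊤ :=
    Eventually.of_forall fun _ => ENNReal.ofReal_lt_top
  have hmap := map_orbitMap hn
  have hg' : Integrable g (orbitConst n • volume) := hg.smul_measure (orbitConst_ne_top hn)
  have hae : (fun p : (ℝ × ℝ) × (Fin n → ℝ) =>
      (ENNReal.ofReal (orbitWeight n p.1.1 p.2)).toReal • g (orbitMap n p))
      =ᵐ[orbitMeasure.prod volume] fun p => orbitWeight n p.1.1 p.2 * g (orbitMap n p) := by
    filter_upwards [ae_orbit_pos n] with p hp
    rw [ENNReal.toReal_ofReal (orbitWeight_nonneg n hp.le _), smul_eq_mul]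
  constructor
  · rw [← hmap] at hg'
    exact ((integrable_withDensity_iff_integrable_smul' hw hlt).1
      (hg'.comp_aemeasurable hm)).congr hae
  · rw [← integral_congr_ae hae, ← integral_withDensity_eq_integral_toReal_smul hw hlt,
      ← smul_eq_mul, ← integral_smul_measure, ← hmap, integral_map hm]
    rw [hmap]
    exact hg'.aestronglyMeasurable

lemma jointScore_affine {n : ℕ} {z : Fin n → ℝ} (h1 : ∑ i, z i = 0) (h2 : ∑ i, z i ^ 2 = n)
    (a b : ℝ) : jointScore n (fun i => a + b * z i) =
      (∑ i, symStableDeriv (a + b * z i) / symStablePdf (a + b * z i) 0) *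
        (jointConst n * Real.exp (-((n : ℝ) * (a ^ 2 + b ^ 2)) / 4)) := by
  rw [← jointPdf_affine h1 h2]
  rfl

/-- Integrating the score along an orbit yields the statistic `T`. -/
lemma integral_orbit_jointScore {n : ℕ} (hn : 3 ≤ n) {x : Fin n → ℝ} (hx : 0 < sampSD n x) :
    ∫ b in Ioi (0 : ℝ), ∫ a : ℝ, orbitWeight n b x * jointScore n (fun i => a + b * x i) =
      jointConst n * (stableLbiStat n (stdized n x) * jointPdf n x) := by
  set s := sampSD n x with hs
  set z := stdized n x with hz
  let Ψ : ℝ → ℝ → ℝ := fun b a =>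
    (∑ i, symStableDeriv (a + b * z i) / symStablePdf (a + b * z i) 0) *
      Real.exp (-((n : ℝ) * (a ^ 2 + b ^ 2)) / 4) * b ^ (n - 2)
  have h : ∀ b a : ℝ, orbitWeight n b x * jointScore n (fun i => a + b * x i) =
      jointConst n * jointPdf n x * (s * Ψ (s * b) (a + b * sampMean n x)) := fun b a => by
    have e : (fun i => a + b * x i) = fun i => (a + b * sampMean n x) + (s * b) * z i := by
      ext i
      rw [eq_mean_add_sd_mul_stdized hx i]
      ring
    rw [e, jointScore_affine (sum_stdized n x) (sum_stdized_sq (by omega) hx), orbitWeight,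
      show n - 1 = n - 2 + 1 by omega, ← hs]
    simp only [Ψ, mul_pow]
    ring
  calc _ = ∫ b in Ioi (0 : ℝ), jointConst n * jointPdf n x * (s * ∫ a, Ψ (s * b) a) := by
        refine integral_congr_ae (Eventually.of_forall fun b => ?_)
        simp only [h, integral_const_mul]
        rw [integral_add_right_eq_self (Ψ (s * b))]
    _ = jointConst n * jointPdf n x * (s * ∫ b in Ioi (0 : ℝ), ∫ a, Ψ (s * b) a) := by
        rw [integral_const_mul, integral_const_mul]
    _ = jointConst n * jointPdf n x * stableLbiStat n z := by
        rw [integral_comp_mul_left_Ioi (fun b => ∫ a, Ψ b a) 0 hx, smul_eq_mul, mul_zero,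
          mul_inv_cancel_left₀ hx.ne']
        rfl
    _ = _ := by ring

/-- A set invariant under location changes and positive rescalings. -/
def LocScaleInvariant {n : ℕ} (R : Set (Fin n → ℝ)) : Prop :=
  ∀ (a b : ℝ), 0 < b → ∀ x : Fin n → ℝ, x ∈ R ↔ (fun i => a + b * x i) ∈ R

/-- On invariant sets, the score may be replaced by a multiple of `T`. -/
lemma setIntegral_jointScore_eq {n : ℕ} (hn : 3 ≤ n) {R : Set (Fin n → ℝ)} (hR : MeasurableSet R)
    (hinv : LocScaleInvariant R) :
    IntegrableOn (fun x => stableLbiStat n (stdized n x) * jointPdf n x) R ∧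
      (orbitConst n).toReal * ∫ x in R, jointScore n x =
        jointConst n * ∫ x in R, stableLbiStat n (stdized n x) * jointPdf n x := by
  have hsc : IntegrableOn (jointScore n) R := (hasDerivAt_setIntegral_prod_symStablePdf n R).1
  obtain ⟨hi, he⟩ := integral_orbit hn ((integrable_indicator_iff hR).2 hsc)
  rw [integral_indicator hR] at he
  have hae : (fun x => ∫ p, orbitWeight n p.1 x * R.indicator (jointScore n) (orbitMap n (p, x))
      ∂orbitMeasure) =ᵐ[volume]
        R.indicator fun x => jointConst n * (stableLbiStat n (stdized n x) * jointPdf n x) := by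
    filter_upwards [ae_sampSD_pos (n := n) (by omega), hi.prod_left_ae] with x hx hxi
    unfold orbitMeasure at hxi ⊢
    rw [integral_prod _ hxi]
    by_cases hxR : x ∈ R
    · rw [indicator_of_mem hxR, ← integral_orbit_jointScore hn hx]
      refine setIntegral_congr_fun measurableSet_Ioi fun b hb => ?_
      refine integral_congr_ae (Eventually.of_forall fun a => ?_)
      beta_reduce
      rw [show orbitMap n ((b, a), x) = fun i => a + b * x i from rfl,
        indicator_of_mem ((hinv a b hb x).1 hxR)]
    · rw [indicator_of_notMem hxR]
      refine setIntegral_eq_zero_of_forall_eq_zero fun b hb => ?_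
      refine integral_eq_zero_of_ae (Eventually.of_forall fun a => ?_)
      beta_reduce
      rw [show orbitMap n ((b, a), x) = fun i => a + b * x i from rfl,
        indicator_of_notMem (fun h => hxR ((hinv a b hb x).2 h)), mul_zero]
      rfl
  have hJ := (jointConst_pos n).ne'
  constructor
  · have := (integrable_indicator_iff hR).1 (hi.integral_prod_right.congr hae)
    simpa [IntegrableOn, hJ] using this.const_mul (jointConst n)⁻¹
  · rw [← he, integral_prod_symm _ hi, integral_congr_ae hae, integral_indicator hR,
      integral_const_mul]

lemma measurable_stableLbiStat (n : ℕ) : Measurable (stableLbiStat n) := by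
  have h1 := measurable_symStablePdf 0
  have h2 : Measurable symStableDeriv := symStableDerivAt_zero ▸ measurable_symStableDerivAt 0
  have hm : StronglyMeasurable fun p : ((Fin n → ℝ) × ℝ) × ℝ =>
      (∑ i, symStableDeriv (p.2 + p.1.2 * p.1.1 i) / symStablePdf (p.2 + p.1.2 * p.1.1 i) 0) *
        Real.exp (-((n : ℝ) * (p.2 ^ 2 + p.1.2 ^ 2)) / 4) * p.1.2 ^ (n - 2) :=
    Measurable.stronglyMeasurable (by fun_prop)
  exact (StronglyMeasurable.integral_prod_right' (ν := volume.restrict (Ioi (0 : ℝ)))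
    (hm.integral_prod_right' (ν := volume))).measurable

lemma measurable_stdized (n : ℕ) : Measurable (stdized n) := by
  have h1 := measurable_sampMean n
  have h2 := measurable_sampSD n
  unfold stdized
  fun_prop

/-- The rejection region of the test based on `T`. -/
def lbiRegion (n : ℕ) (k : ℝ) : Set (Fin n → ℝ) :=
  {x | 0 < sampSD n x ∧ k < stableLbiStat n (stdized n x)}

lemma measurableSet_lbiRegion (n : ℕ) (k : ℝ) : MeasurableSet (lbiRegion n k) :=
  (measurableSet_lt measurable_const (measurable_sampSD n)).inter
    (measurableSet_lt measurable_const
      ((measurable_stableLbiStat n).comp (measurable_stdized n)))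

lemma locScaleInvariant_lbiRegion {n : ℕ} (hn : n ≠ 0) (k : ℝ) :
    LocScaleInvariant (lbiRegion n k) := fun a b hb x => by
  simp only [lbiRegion, mem_ofPred_eq, sampSD_affine hn a hb, stdized_affine hn a hb,
    mul_pos_iff_of_pos_left hb]

/-- Neyman–Pearson: a superlevel set of `T` maximizes `∫ (T - k) f`. -/
lemma setIntegral_le_lbiRegion {n : ℕ} (hn : 2 ≤ n) (k : ℝ) {R : Set (Fin n → ℝ)}
    (hR : MeasurableSet R)
    (hi : Integrable fun x => stableLbiStat n (stdized n x) * jointPdf n x) :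
    ∫ x in R, (stableLbiStat n (stdized n x) * jointPdf n x - k * jointPdf n x) ≤
      ∫ x in lbiRegion n k,
        (stableLbiStat n (stdized n x) * jointPdf n x - k * jointPdf n x) := by
  have hS := measurableSet_lbiRegion n k
  have hV := hi.sub ((integrable_jointPdf n).const_mul k)
  rw [← integral_indicator hR, ← integral_indicator hS]
  refine integral_mono_ae (hV.indicator hR) (hV.indicator hS) ?_
  filter_upwards [ae_sampSD_pos hn] with x hx
  have hG := jointPdf_pos n x
  by_cases h : k < stableLbiStat n (stdized n x)
  · rw [indicator_of_mem (s := lbiRegion n k) ⟨hx, h⟩]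
    exact indicator_apply_le' (fun _ => le_rfl) fun _ => by
      simp only [← sub_mul]; exact mul_nonneg (by linarith) hG.le
  · rw [indicator_of_notMem (s := lbiRegion n k) (fun h' => h h'.2)]
    exact indicator_apply_le' (fun _ => by
      simp only [← sub_mul]; exact mul_nonpos_of_nonpos_of_nonneg (by linarith) hG.le)
      fun _ => le_rfl

/-- Theorem 2 of the paper: `T` gives the locally best invariant test of
normality against the symmetric stable family.  (i) The power function of any location-scale
invariant measurable region `R` is right-differentiable at `θ = 0` with derivative
`∫_R ∑ᵢ [D(xᵢ)/f(xᵢ;0)] ∏ⱼ f(xⱼ;0) dx`; (ii) among invariant regions of the same null size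
as `R* = {x : s(x) > 0, T(z(x)) > k}`, `R*` maximizes this local slope. -/
theorem lbi_test_against_symmetric_stable (n : ℕ) (hn : 3 ≤ n) (k : ℝ)
    (R : Set (Fin n → ℝ)) (hR : MeasurableSet R)
    (hinv : ∀ (a b : ℝ), 0 < b → ∀ x : Fin n → ℝ, x ∈ R ↔ (fun i => a + b * x i) ∈ R) :
    HasDerivWithinAt (fun θ => ∫ x in R, ∏ i, symStablePdf (x i) θ)
        (∫ x in R, (∑ i, symStableDeriv (x i) / symStablePdf (x i) 0) *
          ∏ j, symStablePdf (x j) 0) (Set.Ici 0) 0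
    ∧ ((∫ x in R, ∏ i, symStablePdf (x i) 0)
          = (∫ x in {x : Fin n → ℝ | 0 < sampSD n x ∧ k < stableLbiStat n (stdized n x)},
              ∏ i, symStablePdf (x i) 0) →
        (∫ x in R, (∑ i, symStableDeriv (x i) / symStablePdf (x i) 0) *
            ∏ j, symStablePdf (x j) 0)
          ≤ (∫ x in {x : Fin n → ℝ | 0 < sampSD n x ∧ k < stableLbiStat n (stdized n x)},
              (∑ i, symStableDeriv (x i) / symStablePdf (x i) 0) *
                ∏ j, symStablePdf (x j) 0)) := by
  refine ⟨(hasDerivAt_setIntegral_prod_symStablePdf n R).2.hasDerivWithinAt, fun hsize => ?_⟩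
  change ∫ x in R, jointPdf n x = ∫ x in lbiRegion n k, jointPdf n x at hsize
  change ∫ x in R, jointScore n x ≤ ∫ x in lbiRegion n k, jointScore n x
  have hS := measurableSet_lbiRegion n k
  have hi : Integrable fun x => stableLbiStat n (stdized n x) * jointPdf n x :=
    integrableOn_univ.1 (setIntegral_jointScore_eq hn MeasurableSet.univ
      (fun _ _ _ _ => by simp)).1
  have hk := (integrable_jointPdf n).const_mul k
  have hNP := setIntegral_le_lbiRegion (by omega) k hR hi
  rw [integral_sub hi.integrableOn hk.integrableOn, integral_sub hi.integrableOn hk.integrableOn,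
    integral_const_mul, integral_const_mul, hsize, sub_le_sub_iff_right] at hNP
  have hKpos : 0 < (orbitConst n).toReal :=
    ENNReal.toReal_pos (orbitConst_ne_zero n) (orbitConst_ne_top hn)
  refine le_of_mul_le_mul_left ?_ hKpos
  rw [(setIntegral_jointScore_eq hn hR hinv).2,
    (setIntegral_jointScore_eq hn hS (locScaleInvariant_lbiRegion (by omega) k)).2]
  exact mul_le_mul_of_nonneg_left hNP (jointConst_pos n).le
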